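/- For every real number p with 2 < p < ∞, the real Banach space ℓ_p does not coarsely embed into any real Hilbert space. That is, there is no map f : ℓ_p → H (H a real Hilbert space) together with nondecreasing functions φ₁, φ₂ : [0,∞) → [0,∞) such that φ₁(‖x−y‖) ≤ ‖f(x)−f(y)‖ ≤ φ₂(‖x−y‖) for all x, y ∈ ℓ_p and φ₁(t) → ∞ as t → ∞. -/

import Mathlib

open scoped NNReal ENNReal
open Filter

section CharacterEnergy

variable {G H : Type*} [AddCommGroup G] [Fintype G] [NormedAddCommGroup H] [InnerProductSpace ℝ H]

/-- The squared norm of the Fourier coefficient of `f` at the character `ψ`, split into its real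
and imaginary parts. -/
noncomputable def charEnergy (f : G → H) (ψ : AddChar G ℂ) : ℝ :=
  ‖∑ x, (ψ x).re • f x‖ ^ 2 + ‖∑ x, (ψ x).im • f x‖ ^ 2

lemma charEnergy_nonneg (f : G → H) (ψ : AddChar G ℂ) : 0 ≤ charEnergy f ψ := by
  unfold charEnergy
  positivity

lemma charEnergy_eq_sum_inner (f : G → H) (ψ : AddChar G ℂ) :
    charEnergy f ψ = ∑ x, ∑ y, (ψ (x - y)).re * inner ℝ (f x) (f y) := by
  unfold charEnergy
  rw [← real_inner_self_eq_norm_sq, ← real_inner_self_eq_norm_sq]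
  simp only [sum_inner, inner_sum, real_inner_smul_left, real_inner_smul_right,
    ← Finset.sum_add_distrib]
  refine Finset.sum_congr rfl fun x _ => Finset.sum_congr rfl fun y _ => ?_
  rw [sub_eq_add_neg, AddChar.map_add_eq_mul, AddChar.map_neg_eq_conj, Complex.mul_re,
    Complex.conj_re, Complex.conj_im, real_inner_comm (f x) (f y)]
  ring

/-- Parseval's identity for functions from a finite abelian group to a real Hilbert space. -/
lemma sum_charEnergy (f : G → H) :
    ∑ ψ, charEnergy f ψ = Fintype.card G * ∑ x, ‖f x‖ ^ 2 := by
  classical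
  simp only [charEnergy_eq_sum_inner]
  rw [Finset.sum_comm, Finset.mul_sum]
  refine Finset.sum_congr rfl fun x _ => ?_
  rw [Finset.sum_comm, Finset.sum_eq_single x]
  · rw [← Finset.sum_mul, ← Complex.re_sum, AddChar.sum_apply_eq_ite]
    simp
  · intro y _ hy
    rw [← Finset.sum_mul, ← Complex.re_sum, AddChar.sum_apply_eq_ite,
      if_neg (sub_ne_zero.2 hy.symm)]
    simp
  · simp

lemma charEnergy_shift_sub (f : G → H) (z : G) (ψ : AddChar G ℂ) :
    charEnergy (fun x => f (x + z) - f x) ψ = ‖ψ z - 1‖ ^ 2 * charEnergy f ψ := by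
  have key (l : ℂ → ℝ) : ∑ x, l (ψ x) • (f (x + z) - f x) =
      ∑ x, (l (ψ x * (starRingEnd ℂ) (ψ z)) - l (ψ x)) • f x := by
    simp only [smul_sub, sub_smul, Finset.sum_sub_distrib]
    congr 1
    refine Fintype.sum_equiv (Equiv.addRight z) _ _ fun x => ?_
    simp only [Equiv.coe_addRight]
    rw [← AddChar.map_neg_eq_conj, ← AddChar.map_add_eq_mul, add_neg_cancel_right]
  unfold charEnergy
  rw [key Complex.re, key Complex.im]
  set A := ∑ x, (ψ x).re • f x
  set B := ∑ x, (ψ x).im • f x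
  have h1 : ∑ x, ((ψ x * (starRingEnd ℂ) (ψ z)).re - (ψ x).re) • f x =
      ((ψ z).re - 1) • A + (ψ z).im • B := by
    simp only [A, B, Finset.smul_sum, smul_smul, ← Finset.sum_add_distrib, ← add_smul]
    refine Finset.sum_congr rfl fun x _ => ?_
    congr 1
    simp
    ring
  have h2 : ∑ x, ((ψ x * (starRingEnd ℂ) (ψ z)).im - (ψ x).im) • f x =
      ((ψ z).re - 1) • B - (ψ z).im • A := by
    simp only [A, B, Finset.smul_sum, smul_smul, ← Finset.sum_sub_distrib, ← sub_smul]
    refine Finset.sum_congr rfl fun x _ => ?_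
    congr 1
    simp
    ring
  rw [h1, h2, norm_add_sq_real, norm_sub_sq_real, ← Complex.normSq_eq_norm_sq,
    Complex.normSq_apply]
  simp only [norm_smul, real_inner_smul_left, real_inner_smul_right, mul_pow, Real.norm_eq_abs,
    sq_abs, real_inner_comm B A, Complex.sub_re, Complex.sub_im, Complex.one_re, Complex.one_im]
  ring

lemma card_mul_sum_norm_shift_sub_sq (f : G → H) (z : G) :
    Fintype.card G * ∑ x, ‖f (x + z) - f x‖ ^ 2 = ∑ ψ, ‖ψ z - 1‖ ^ 2 * charEnergy f ψ := by
  rw [← sum_charEnergy fun x => f (x + z) - f x]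
  simp only [charEnergy_shift_sub]

lemma card_mul_sum_norm_shift_sub_shift_sq (f : G → H) (y z : G) :
    Fintype.card G * ∑ x, ‖f (x + y) - f (x + z)‖ ^ 2 =
      ∑ ψ, ‖ψ y - ψ z‖ ^ 2 * charEnergy f ψ := by
  have h : ∑ x, ‖f (x + y) - f (x + z)‖ ^ 2 = ∑ x, ‖f (x + (y - z)) - f x‖ ^ 2 := by
    refine Fintype.sum_equiv (Equiv.addRight z) _ _ fun x => ?_
    simp only [Equiv.coe_addRight]
    rw [add_assoc, add_sub_cancel]
  rw [h, card_mul_sum_norm_shift_sub_sq]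
  refine Finset.sum_congr rfl fun ψ _ => ?_
  have h1 : ψ y - ψ z = (ψ (y - z) - 1) * ψ z := by
    rw [sub_mul, ← AddChar.map_add_eq_mul, sub_add_cancel, one_mul]
  rw [h1, norm_mul, AddChar.norm_apply, mul_one]

end CharacterEnergy

section MetricCotype

variable {ι : Type*} [Fintype ι]

lemma prod_one_sub_le_one_sub_half_sum (s : ι → ℝ) (h0 : ∀ j, 0 ≤ s j) (h1 : ∑ j, s j ≤ 1) :
    ∏ j, (1 - s j) ≤ 1 - (∑ j, s j) / 2 := by
  have hs : 0 ≤ ∑ j, s j := Finset.sum_nonneg fun j _ => h0 j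
  have hle (j) : s j ≤ 1 :=
    (Finset.single_le_sum (fun i _ => h0 i) (Finset.mem_univ j)).trans h1
  have hexp : ∏ j, (1 - s j) ≤ Real.exp (-∑ j, s j) := by
    rw [← Finset.sum_neg_distrib, Real.exp_sum]
    exact Finset.prod_le_prod (fun j _ => sub_nonneg.2 (hle j))
      fun j _ => Real.one_sub_le_exp_neg _
  refine hexp.trans ?_
  rw [Real.exp_neg, inv_le_comm₀ (Real.exp_pos _) (by linarith)]
  refine le_trans ?_ (Real.add_one_le_exp _)
  rw [inv_le_iff_one_le_mul₀ (by linarith)]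
  nlinarith

lemma sum_sum_norm_sub_sq {κ : Type*} [Fintype κ] (a : κ → ℂ) (ha : ∀ k, ‖a k‖ = 1) :
    ∑ k, ∑ l, ‖a k - a l‖ ^ 2 = 2 * (Fintype.card κ : ℝ) ^ 2 - 2 * ‖∑ k, a k‖ ^ 2 := by
  have h1 (k l) : ‖a k - a l‖ ^ 2 = 2 - 2 * inner ℝ (a k) (a l) := by
    rw [norm_sub_sq_real, ha, ha]
    ring
  simp only [h1, Finset.sum_sub_distrib, ← Finset.mul_sum, ← inner_sum, ← sum_inner]
  rw [real_inner_self_eq_norm_sq]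
  simp
  ring

/-- The metric cotype inequality at the level of a single character. -/
lemma sum_norm_pow_sub_one_sq_le (ω : ι → ℂ) (hω : ∀ j, ‖ω j‖ = 1) (k : ℕ)
    (hk : 0 < k) (hcard : Fintype.card ι ≤ k ^ 2) :
    (4 : ℝ) ^ Fintype.card ι * ∑ j, ‖ω j ^ k - 1‖ ^ 2 ≤
      4 * (k : ℝ) ^ 2 * ∑ S : Finset ι, ∑ T : Finset ι, ‖∏ j ∈ S, ω j - ∏ j ∈ T, ω j‖ ^ 2 := by
  have hk' : (0 : ℝ) < k := by exact_mod_cast hk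
  set s : ι → ℝ := fun j => ‖ω j ^ k - 1‖ ^ 2 / (4 * (k : ℝ) ^ 2) with hs
  have hsum : ∑ j, ‖ω j ^ k - 1‖ ^ 2 = 4 * (k : ℝ) ^ 2 * ∑ j, s j := by
    rw [hs, ← Finset.sum_div]
    field_simp
  have hs0 (j) : 0 ≤ s j := by positivity
  have hs1 (j) : s j ≤ 1 / (k : ℝ) ^ 2 := by
    have : ‖ω j ^ k - 1‖ ≤ 2 := by
      refine (norm_sub_le _ _).trans ?_
      rw [norm_pow, hω]
      norm_num
    have h2 : ‖ω j ^ k - 1‖ ^ 2 ≤ 4 := by nlinarith [norm_nonneg (ω j ^ k - 1)]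
    rw [hs]
    simp only
    rw [div_le_div_iff₀ (by positivity) (by positivity)]
    nlinarith [sq_nonneg (k : ℝ)]
  have hS1 : ∑ j, s j ≤ 1 := by
    refine (Finset.sum_le_sum fun j _ => hs1 j).trans ?_
    rw [Finset.sum_const, Finset.card_univ, nsmul_eq_mul, mul_one_div,
      div_le_one (by positivity)]
    exact_mod_cast hcard
  have hfactor (j) : ‖1 + ω j‖ ^ 2 ≤ 4 * (1 - s j) := by
    have hpow : ‖ω j ^ k - 1‖ ≤ k * ‖ω j - 1‖ := by
      rw [← geom_sum_mul, norm_mul]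
      gcongr
      refine (norm_sum_le _ _).trans ?_
      simp [hω]
    have hsq : 4 * s j ≤ ‖ω j - 1‖ ^ 2 := by
      rw [hs]
      simp only
      rw [← mul_div_assoc, div_le_iff₀ (by positivity)]
      have := pow_le_pow_left₀ (norm_nonneg _) hpow 2
      nlinarith
    have hpar := parallelogram_law_with_norm ℝ (ω j) 1
    rw [hω, norm_one, add_comm (ω j) 1] at hpar
    nlinarith
  have hprod : ‖∑ S : Finset ι, ∏ j ∈ S, ω j‖ ^ 2 ≤
      4 ^ Fintype.card ι * (1 - (∑ j, s j) / 2) := by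
    have : ∑ S : Finset ι, ∏ j ∈ S, ω j = ∏ j, (1 + ω j) := by
      rw [Finset.prod_one_add, Finset.powerset_univ]
    rw [this, norm_prod, ← Finset.prod_pow]
    calc ∏ j, ‖1 + ω j‖ ^ 2 ≤ ∏ j, 4 * (1 - s j) :=
          Finset.prod_le_prod (fun j _ => by positivity) fun j _ => hfactor j
      _ = 4 ^ Fintype.card ι * ∏ j, (1 - s j) := by
          rw [Finset.prod_mul_distrib, Finset.prod_const, Finset.card_univ]
      _ ≤ _ := by
          gcongr
          exact prod_one_sub_le_one_sub_half_sum s hs0 hS1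
  rw [sum_sum_norm_sub_sq _ fun S => by rw [norm_prod]; simp [hω], hsum, Fintype.card_finset]
  have h4 : ((2 ^ Fintype.card ι : ℕ) : ℝ) ^ 2 = 4 ^ Fintype.card ι := by
    push_cast
    rw [← pow_mul, mul_comm, pow_mul]
    norm_num
  rw [h4, mul_left_comm]
  refine mul_le_mul_of_nonneg_left ?_ (by positivity)
  linarith

/-- A metric cotype 2 inequality for functions from a finite abelian group to a Hilbert space. -/
lemma metric_cotype_two {G H : Type*} [AddCommGroup G] [Fintype G] [NormedAddCommGroup H]
    [InnerProductSpace ℝ H] (f : G → H) (e : ι → G) (k : ℕ) (hk : 0 < k)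
    (hcard : Fintype.card ι ≤ k ^ 2) :
    (4 : ℝ) ^ Fintype.card ι * ∑ j, ∑ x, ‖f (x + k • e j) - f x‖ ^ 2 ≤
      4 * (k : ℝ) ^ 2 * ∑ S : Finset ι, ∑ T : Finset ι,
        ∑ x, ‖f (x + ∑ j ∈ S, e j) - f (x + ∑ j ∈ T, e j)‖ ^ 2 := by
  have hG : (0 : ℝ) < Fintype.card G := by exact_mod_cast Fintype.card_pos
  refine le_of_mul_le_mul_left ?_ hG
  rw [mul_left_comm, mul_left_comm (Fintype.card G : ℝ)]
  simp only [Finset.mul_sum (Finset.univ : Finset ι),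
    Finset.mul_sum (Finset.univ : Finset (Finset ι)),
    card_mul_sum_norm_shift_sub_sq, card_mul_sum_norm_shift_sub_shift_sq,
    Finset.mul_sum (Finset.univ : Finset (AddChar G ℂ))]
  rw [Finset.sum_comm]
  simp_rw [Finset.sum_comm (t := (Finset.univ : Finset (AddChar G ℂ)))]
  refine Finset.sum_le_sum fun ψ _ => ?_
  have hψ := mul_le_mul_of_nonneg_right
    (sum_norm_pow_sub_one_sq_le (fun j => ψ (e j)) (fun j => ψ.norm_apply _) k hk hcard)
    (charEnergy_nonneg f ψ)
  have hprod (S : Finset ι) : ψ (∑ j ∈ S, e j) = ∏ j ∈ S, ψ (e j) :=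
    map_prod ψ.toMonoidHom (fun j => Multiplicative.ofAdd (e j)) S
  simpa only [Finset.mul_sum, Finset.sum_mul, AddChar.map_nsmul_eq_pow, hprod, mul_assoc] using hψ

end MetricCotype

/-- A copy of the complex `ℓ_p^n` inside the real sequence space `ℓ_p`. -/
lemma exists_complex_pi_to_lp (p : ℝ) (hp : 0 < p) [Fact (1 ≤ ENNReal.ofReal p)] (n : ℕ) :
    ∃ L : (Fin n → ℂ) →+ lp (fun _ : ℕ => ℝ) (ENNReal.ofReal p),
      (∀ z C, 0 ≤ C → (∀ j, ‖z j‖ ≤ C) → ‖L z‖ ≤ ((2 * n : ℕ) : ℝ) ^ (1 / p) * C) ∧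
      ∀ z j, ‖z j‖ ≤ 2 * ‖L z‖ := by
  let c (z : Fin n → ℂ) (i : ℕ) : ℝ :=
    if h : i / 2 < n then if i % 2 = 0 then (z ⟨i / 2, h⟩).re else (z ⟨i / 2, h⟩).im else 0
  have hc_add (z w i) : c (z + w) i = c z i + c w i := by
    simp only [c]
    split_ifs <;> simp
  have hp' : (ENNReal.ofReal p).toReal = p := ENNReal.toReal_ofReal hp.le
  let L : (Fin n → ℂ) →+ lp (fun _ : ℕ => ℝ) (ENNReal.ofReal p) := AddMonoidHom.mk'
    (fun z => ∑ i ∈ Finset.range (2 * n), lp.single (ENNReal.ofReal p) i (c z i)) fun z w => by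
      simp only [hc_add, lp.single_add, Finset.sum_add_distrib]
  have hL (z) : L z = ∑ i ∈ Finset.range (2 * n), lp.single (ENNReal.ofReal p) i (c z i) := rfl
  refine ⟨L, fun z C hC hz => ?_, fun z j => ?_⟩
  · have hci (i) : ‖c z i‖ ≤ C := by
      simp only [c]
      split_ifs with h1 h2
      · exact (Complex.abs_re_le_norm _).trans (hz _)
      · exact (Complex.abs_im_le_norm _).trans (hz _)
      · simpa using hC
    have hsum := lp.norm_sum_single (E := fun _ : ℕ => ℝ) (p := ENNReal.ofReal p)
      (by rwa [hp']) (c z) (Finset.range (2 * n))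
    rw [← hL, hp'] at hsum
    rw [← Real.rpow_le_rpow_iff (norm_nonneg _) (by positivity) hp, hsum,
      Real.mul_rpow (by positivity) hC, ← Real.rpow_mul (by positivity),
      one_div_mul_cancel hp.ne', Real.rpow_one]
    calc ∑ i ∈ Finset.range (2 * n), ‖c z i‖ ^ p ≤ ∑ i ∈ Finset.range (2 * n), C ^ p :=
          Finset.sum_le_sum fun i _ => Real.rpow_le_rpow (norm_nonneg _) (hci i) hp.le
      _ = _ := by simp
  · have hcoord (i) (hi : i < 2 * n) : |c z i| ≤ ‖L z‖ := by
      have h := lp.norm_apply_le_norm (p := ENNReal.ofReal p) (by simpa using hp) (L z) i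
      have hval : L z i = c z i := by
        rw [hL, lp.coeFn_sum, Finset.sum_apply]
        simp only [lp.coeFn_single]
        rw [Finset.sum_pi_single, if_pos (Finset.mem_range.2 hi)]
      rwa [hval] at h
    have hre : c z (2 * j) = (z j).re := by simp [c]
    have him : c z (2 * j + 1) = (z j).im := by
      have h1 : (2 * (j : ℕ) + 1) / 2 = j := by omega
      have h2 : (2 * (j : ℕ) + 1) % 2 = 1 := by omega
      simp [c, h1, h2]
    have h1 := hcoord (2 * j) (by omega)
    have h2 := hcoord (2 * j + 1) (by omega)
    rw [hre] at h1
    rw [him] at h2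
    linarith [Complex.norm_le_abs_re_add_abs_im (z j)]

lemma ZMod.stdAddChar_natCast_half (k : ℕ) [NeZero (2 * k)] :
    ZMod.stdAddChar ((k : ℕ) : ZMod (2 * k)) = -1 := by
  have hk : (k : ℂ) ≠ 0 := by
    have := NeZero.ne (2 * k)
    exact_mod_cast (by omega : k ≠ 0)
  have h := ZMod.stdAddChar_coe (N := 2 * k) (k : ℤ)
  rw [Int.cast_natCast] at h
  rw [h, ← Complex.exp_pi_mul_I]
  congr 1
  push_cast
  field_simp

lemma ZMod.norm_stdAddChar_one_sub_one_le (N : ℕ) [NeZero N] :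
    ‖ZMod.stdAddChar (1 : ZMod N) - 1‖ ≤ 2 * Real.pi / N := by
  have h := ZMod.stdAddChar_coe (N := N) 1
  rw [Int.cast_one] at h
  have h2 : 2 * Real.pi * Complex.I * ((1 : ℤ) : ℂ) / N =
      Complex.I * ((2 * Real.pi / N : ℝ) : ℂ) := by
    push_cast
    ring
  rw [h, h2]
  refine (Real.norm_exp_I_mul_ofReal_sub_one_le).trans ?_
  rw [Real.norm_of_nonneg (by positivity)]

/-- The discrete torus `(ℤ/2k)^(k²)`, scaled so that unit steps along arbitrary sets of coordinates
have bounded length, sits in `ℓ_p` with antipodal points at distance at least `k ^ (1 - 2 / p)`. -/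
lemma exists_discrete_torus_to_lp (p : ℝ) (hp : 1 ≤ p) [Fact (1 ≤ ENNReal.ofReal p)]
    (k : ℕ) (hk : 0 < k) :
    ∃ F : (Fin (k ^ 2) → ZMod (2 * k)) → lp (fun _ : ℕ => ℝ) (ENNReal.ofReal p),
      (∀ x j, (k : ℝ) ^ (1 - 2 / p) ≤ ‖F (x + k • Pi.single j (1 : ZMod (2 * k))) - F x‖) ∧
      ∀ x (S T : Finset (Fin (k ^ 2))),
        ‖F (x + ∑ j ∈ S, Pi.single j (1 : ZMod (2 * k))) -
          F (x + ∑ j ∈ T, Pi.single j (1 : ZMod (2 * k)))‖ ≤ 2 * Real.pi := by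
  have hp0 : 0 < p := by linarith
  have hk' : (0 : ℝ) < k := by exact_mod_cast hk
  have : NeZero (2 * k) := ⟨by omega⟩
  obtain ⟨L, hL1, hL2⟩ := exists_complex_pi_to_lp p hp0 (k ^ 2)
  set R : ℝ := (k : ℝ) ^ (1 - 2 / p)
  have hR : 0 < R := by positivity
  let u (x : Fin (k ^ 2) → ZMod (2 * k)) (j : Fin (k ^ 2)) : ℂ := R * ZMod.stdAddChar (x j)
  refine ⟨fun x => L (u x), fun x j => ?_, fun x S T => ?_⟩
  · rw [← map_sub]
    have h := hL2 (u (x + k • Pi.single j (1 : ZMod (2 * k))) - u x) j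
    have h1 : (u (x + k • Pi.single j (1 : ZMod (2 * k))) - u x) j =
        -2 * R * ZMod.stdAddChar (x j) := by
      have hj : (k • Pi.single j (1 : ZMod (2 * k)) : Fin (k ^ 2) → ZMod (2 * k)) j = k := by
        rw [Pi.smul_apply, Pi.single_eq_same, nsmul_one]
      simp only [u, Pi.sub_apply, Pi.add_apply, hj, AddChar.map_add_eq_mul,
        ZMod.stdAddChar_natCast_half]
      ring
    rw [h1, norm_mul, norm_mul, AddChar.norm_apply, Complex.norm_real, norm_neg,
      Real.norm_of_nonneg hR.le, Complex.norm_ofNat] at h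
    linarith
  · rw [← map_sub]
    have hcoord (S : Finset (Fin (k ^ 2))) (j) :
        (∑ i ∈ S, Pi.single i 1 : Fin (k ^ 2) → ZMod (2 * k)) j = if j ∈ S then 1 else 0 := by
      rw [Finset.sum_apply, Finset.sum_pi_single]
    have hstep := ZMod.norm_stdAddChar_one_sub_one_le (2 * k)
    have hstep' : 2 * Real.pi / ((2 * k : ℕ) : ℝ) = Real.pi / k := by
      push_cast
      field_simp
    rw [hstep'] at hstep
    refine (hL1 _ (R * (Real.pi / k)) (by positivity) fun j => ?_).trans ?_
    · simp only [u, Pi.sub_apply, Pi.add_apply, hcoord, AddChar.map_add_eq_mul, ← mul_sub, norm_mul,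
        AddChar.norm_apply, Complex.norm_real, Real.norm_of_nonneg hR.le, one_mul]
      gcongr
      split_ifs
      · simpa using by positivity
      · simpa using hstep
      · rw [norm_sub_rev]
        simpa using hstep
      · simpa using by positivity
    · have h2 : (2 : ℝ) ^ (1 / p) ≤ 2 := by
        have := Real.rpow_le_rpow_of_exponent_le (one_le_two (α := ℝ))
          ((div_le_one hp0).2 hp)
        simpa using this
      have hkR : ((k : ℝ) ^ 2) ^ (1 / p) * R = k := by
        rw [← Real.rpow_natCast, ← Real.rpow_mul hk'.le, ← Real.rpow_add hk']
        have : ((2 : ℕ) : ℝ) * (1 / p) + (1 - 2 / p) = 1 := by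
          push_cast
          ring
        rw [this, Real.rpow_one]
      push_cast
      rw [Real.mul_rpow (by positivity) (by positivity)]
      calc (2 : ℝ) ^ (1 / p) * ((k : ℝ) ^ 2) ^ (1 / p) * (R * (Real.pi / k))
          = (2 : ℝ) ^ (1 / p) * ((((k : ℝ) ^ 2) ^ (1 / p) * R) * (Real.pi / k)) := by ring
        _ = (2 : ℝ) ^ (1 / p) * Real.pi := by
            rw [hkR]
            field_simp
        _ ≤ 2 * Real.pi := by gcongr

/-- **ℓ_p (p > 2) does not coarsely embed into a Hilbert space.**
For every real `p` with `2 < p < ∞`, there is no map `f : ℓ_p → H` into a real Hilbert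
space `H` together with nondecreasing `φ₁ φ₂ : [0,∞) → [0,∞)` such that
`φ₁(‖x−y‖) ≤ ‖f x − f y‖ ≤ φ₂(‖x−y‖)` for all `x, y` and `φ₁(t) → ∞` as `t → ∞`. -/
theorem lp_not_coarsely_embeds_into_hilbert
    (p : ℝ) (hp : 2 < p) [Fact (1 ≤ ENNReal.ofReal p)]
    (H : Type*) [NormedAddCommGroup H] [InnerProductSpace ℝ H] :
    ¬ ∃ (f : lp (fun _ : ℕ => ℝ) (ENNReal.ofReal p) → H) (φ₁ φ₂ : ℝ≥0 → ℝ≥0),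
        Monotone φ₁ ∧ Monotone φ₂ ∧
        Tendsto φ₁ atTop atTop ∧
        ∀ x y, φ₁ ‖x - y‖₊ ≤ ‖f x - f y‖₊ ∧ ‖f x - f y‖₊ ≤ φ₂ ‖x - y‖₊ := by
  rintro ⟨f, φ₁, φ₂, hφ₁, hφ₂, htends, hf⟩
  set D : ℝ≥0 := φ₂ (2 * Real.pi).toNNReal
  have bound (k : ℕ) (hk : 0 < k) : φ₁ ((k : ℝ) ^ (1 - 2 / p)).toNNReal ≤ 2 * D := by
    have hk' : (0 : ℝ) < k := by exact_mod_cast hk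
    have : NeZero (2 * k) := ⟨by omega⟩
    obtain ⟨F, hF1, hF2⟩ := exists_discrete_torus_to_lp p (by linarith) k hk
    set A : ℝ≥0 := φ₁ ((k : ℝ) ^ (1 - 2 / p)).toNNReal
    have hlow (x j) : (A : ℝ) ≤ ‖f (F (x + k • Pi.single j (1 : ZMod (2 * k)))) - f (F x)‖ := by
      refine NNReal.coe_le_coe.2 ((hφ₁ ?_).trans (hf _ _).1)
      exact Real.toNNReal_le_iff_le_coe.2 (hF1 x j)
    have hupp (x) (S T : Finset (Fin (k ^ 2))) :
        ‖f (F (x + ∑ j ∈ S, Pi.single j (1 : ZMod (2 * k)))) -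
          f (F (x + ∑ j ∈ T, Pi.single j (1 : ZMod (2 * k))))‖ ≤ D := by
      refine NNReal.coe_le_coe.2 ((hf _ _).2.trans (hφ₂ ?_))
      exact NNReal.le_toNNReal_of_coe_le (hF2 x S T)
    have hcot := metric_cotype_two (fun x => f (F x)) (fun j => Pi.single j 1) k hk (by simp)
    have hmain := (mul_le_mul_of_nonneg_left (Finset.sum_le_sum fun j (_ : j ∈ Finset.univ) =>
      Finset.sum_le_sum fun x (_ : x ∈ Finset.univ) =>
        pow_le_pow_left₀ A.coe_nonneg (hlow x j) 2) (by positivity)).trans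
      (hcot.trans (mul_le_mul_of_nonneg_left (Finset.sum_le_sum fun S _ =>
        Finset.sum_le_sum fun T _ => Finset.sum_le_sum fun x _ =>
          pow_le_pow_left₀ (norm_nonneg _) (hupp x S T) 2) (by positivity)))
    simp only [Finset.sum_const, Finset.card_univ, nsmul_eq_mul, Fintype.card_finset,
      Fintype.card_fin] at hmain
    set g : ℝ := (Fintype.card (Fin (k ^ 2) → ZMod (2 * k)) : ℝ)
    have hg : 0 < g := by
      simp only [g]
      exact_mod_cast Fintype.card_pos
    have h4 : (4 : ℝ) ^ (k ^ 2) = 2 ^ (k ^ 2) * 2 ^ (k ^ 2) := by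
      rw [← mul_pow]
      norm_num
    push_cast at hmain
    have hfac : (4 : ℝ) ^ (k ^ 2) * k ^ 2 * g * (A : ℝ) ^ 2 ≤
        (4 : ℝ) ^ (k ^ 2) * k ^ 2 * g * (2 * (D : ℝ)) ^ 2 := by
      calc _ = (4 : ℝ) ^ (k ^ 2) * ((k : ℝ) ^ 2 * (g * (A : ℝ) ^ 2)) := by ring
        _ ≤ _ := hmain
        _ = _ := by
          rw [h4]
          ring
    have hsq := le_of_mul_le_mul_left hfac (by positivity)
    have := (pow_le_pow_iff_left₀ A.coe_nonneg (by positivity) two_ne_zero).1 hsq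
    exact_mod_cast this
  have hexp : 0 < 1 - 2 / p := by
    rw [sub_pos, div_lt_one (by linarith)]
    exact hp
  have hlim : Tendsto (fun k : ℕ => φ₁ ((k : ℝ) ^ (1 - 2 / p)).toNNReal) atTop atTop :=
    htends.comp (tendsto_real_toNNReal_atTop.comp
      ((tendsto_rpow_atTop hexp).comp tendsto_natCast_atTop_atTop))
  obtain ⟨k, hk, hk0⟩ := ((hlim.eventually_gt_atTop (2 * D)).and (eventually_gt_atTop 0)).exists
  exact absurd (bound k hk0) (not_le.2 hk)
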